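/- Let R be a ring. Then the category sMod(R) of simplicial left R-modules is a cofibrantly generated model category in which a morphism f : M → N is: a fibration if Nor(f)_i : Nor(M)_i → Nor(N)_i is surjective for every i ≥ 1; a cofibration if Nor(f)_i is injective and Coker(Nor(f)_i) is a projective left R-module for every i ≥ 0; and a weak equivalence if Nor(f) : Nor(M) → Nor(N) is a quasi-isomorphism of connective chain complexes. -/

import Mathlib

open CategoryTheory Limits

universe v u

namespace Paper

variable {C : Type u} [Category.{v} C]

/-- `f` is a retract of `g` in the arrow category. -/
def IsRetract {A B X Y : C} (f : A ⟶ B) (g : X ⟶ Y) : Prop :=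
  ∃ (h : A ⟶ X) (l : X ⟶ A) (p : B ⟶ Y) (q : Y ⟶ B),
    h ≫ l = 𝟙 A ∧ p ≫ q = 𝟙 B ∧ h ≫ g = f ≫ p ∧ g ≫ q = l ≫ f

/-- The class of morphisms having the right lifting property against all members of `T`. -/
def rlp (T : MorphismProperty C) : MorphismProperty C :=
  fun _ _ g => ∀ ⦃A B : C⦄ (f : A ⟶ B), T f → HasLiftingProperty f g

/-- The class of morphisms having the left lifting property against all members of `T`. -/
def llp (T : MorphismProperty C) : MorphismProperty C :=
  fun _ _ f => ∀ ⦃X Y : C⦄ (g : X ⟶ Y), T g → HasLiftingProperty f g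

/-- The morphism property determined by a set of arrows. -/
def ofArrows (S : Set (Arrow C)) : MorphismProperty C :=
  fun _ _ f => Arrow.mk f ∈ S

/-- An object `A` is small with respect to a class `T` of morphisms if `Hom(A, -)`
preserves colimits of `ℕ`-indexed sequences of morphisms belonging to `T`. -/
def IsSmallWrt (T : MorphismProperty C) (A : C) : Prop :=
  ∀ (F : ℕ ⥤ C), (∀ n : ℕ, T (F.map (homOfLE (Nat.le_succ n)))) →
    ∀ (c : Cocone F), Nonempty (IsColimit c) →
      Nonempty (IsColimit ((coyoneda.obj (Opposite.op A)).mapCocone c))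

/-- A set of morphisms permits the small object argument if the source of each of its members
is small with respect to `llp (rlp S)`. -/
def PermitsSOA (S : Set (Arrow C)) : Prop :=
  ∀ a ∈ S, IsSmallWrt (llp (rlp (ofArrows S))) a.left

/-- A model structure on a category: distinguished classes of weak equivalences, fibrations and
cofibrations on a bicomplete category, satisfying the lifting, retract, two-out-of-three and
factorization axioms. -/
structure ModelStructure (C : Type u) [Category.{v} C] where
  hasLimits : HasLimits C
  hasColimits : HasColimits C
  W : MorphismProperty C
  Fib : MorphismProperty C
  Cof : MorphismProperty C
  lifting_left : ∀ {A B X Y : C} (f : A ⟶ B) (g : X ⟶ Y),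
    Cof f → W f → Fib g → HasLiftingProperty f g
  lifting_right : ∀ {A B X Y : C} (f : A ⟶ B) (g : X ⟶ Y),
    Cof f → Fib g → W g → HasLiftingProperty f g
  retract_fib : ∀ {A B X Y : C} {f : A ⟶ B} {g : X ⟶ Y}, IsRetract f g → Fib g → Fib f
  retract_cof : ∀ {A B X Y : C} {f : A ⟶ B} {g : X ⟶ Y}, IsRetract f g → Cof g → Cof f
  retract_w : ∀ {A B X Y : C} {f : A ⟶ B} {g : X ⟶ Y}, IsRetract f g → W g → W f
  two_three_comp : ∀ {A B Z : C} (f : A ⟶ B) (g : B ⟶ Z), W f → W g → W (f ≫ g)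
  two_three_left : ∀ {A B Z : C} (f : A ⟶ B) (g : B ⟶ Z), W (f ≫ g) → W g → W f
  two_three_right : ∀ {A B Z : C} (f : A ⟶ B) (g : B ⟶ Z), W (f ≫ g) → W f → W g
  factor_trivCof_fib : ∀ {A B : C} (f : A ⟶ B), ∃ (Z : C) (i : A ⟶ Z) (p : Z ⟶ B),
    Cof i ∧ W i ∧ Fib p ∧ i ≫ p = f
  factor_cof_trivFib : ∀ {A B : C} (f : A ⟶ B), ∃ (Z : C) (i : A ⟶ Z) (p : Z ⟶ B),
    Cof i ∧ Fib p ∧ W p ∧ i ≫ p = f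

/-- A model structure is cofibrantly generated by sets `I`, `J` of morphisms if both permit the
small object argument, `rlp I` is the class of trivial fibrations and `rlp J` the class of
fibrations. -/
structure IsCofibrantlyGenerated (M : ModelStructure C) (I J : Set (Arrow C)) : Prop where
  permits_I : PermitsSOA I
  permits_J : PermitsSOA J
  rlp_I : ∀ {X Y : C} (g : X ⟶ Y), rlp (ofArrows I) g ↔ (M.Fib g ∧ M.W g)
  rlp_J : ∀ {X Y : C} (g : X ⟶ Y), rlp (ofArrows J) g ↔ M.Fib g

end Paper

namespace Paper

section Recognition

variable {C : Type u} [Category.{v} C]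

lemma IsRetract.nonempty_retractArrow {A B X Y : C} {f : A ⟶ B} {g : X ⟶ Y}
    (h : IsRetract f g) : Nonempty (RetractArrow f g) := by
  obtain ⟨i, r, p, q, h₁, h₂, h₃, h₄⟩ := h
  exact ⟨{
    i := Arrow.homMk i p h₃
    r := Arrow.homMk r q h₄.symm
    retract := by ext <;> simpa }⟩

lemma ofArrows_setOf (T : MorphismProperty C) : ofArrows {a : Arrow C | T a.hom} = T := rfl

lemma rlp_eq (T : MorphismProperty C) : rlp T = T.rlp := by
  ext
  exact ⟨fun h _ _ f hf ↦ h f hf, fun h _ _ f hf ↦ h f hf⟩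

/-- Two classes of generators admitting the small object argument, together with a class of weak
equivalences compatible with them, define a model structure. -/
def ModelStructure.ofGenerators [HasLimits C] [HasColimits C] (W I J : MorphismProperty C)
    [W.HasTwoOutOfThreeProperty] [W.IsStableUnderRetracts]
    [I.rlp.llp.HasFactorization I.rlp] [J.rlp.llp.HasFactorization J.rlp]
    (hI : I.rlp = J.rlp ⊓ W) (hJ : J.rlp.llp ≤ W) : ModelStructure C where
  hasLimits := inferInstance
  hasColimits := inferInstance
  W := W
  Fib := J.rlp
  Cof := I.rlp.llp
  lifting_left := by
    intro A B X Y f g hf hw hg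
    let F := MorphismProperty.factorizationData J.rlp.llp J.rlp f
    have hp : I.rlp F.p := by
      rw [hI]
      refine ⟨F.hp, W.of_precomp F.i F.p (hJ _ F.hi) ?_⟩
      rwa [F.fac]
    have := hf _ hp
    have := F.hi _ hg
    have sq : CommSq F.i f F.p (𝟙 B) := ⟨by simp [F.fac]⟩
    let r : RetractArrow f F.i :=
      { i := Arrow.homMk (𝟙 _) sq.lift (by simp)
        r := Arrow.homMk (𝟙 _) F.p (by simp [F.fac])
        retract := by ext <;> simp }
    exact r.leftLiftingProperty g
  lifting_right := fun f g hf hg hw ↦ hf _ (hI ▸ ⟨hg, hw⟩)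
  retract_fib := fun h hg ↦ J.rlp.of_retract h.nonempty_retractArrow.some hg
  retract_cof := fun h hg ↦ I.rlp.llp.of_retract h.nonempty_retractArrow.some hg
  retract_w := fun h hg ↦ W.of_retract h.nonempty_retractArrow.some hg
  two_three_comp := fun f g hf hg ↦ W.comp_mem f g hf hg
  two_three_left := fun f g hfg hg ↦ W.of_postcomp f g hg hfg
  two_three_right := fun f g hfg hf ↦ W.of_precomp f g hf hfg
  factor_trivCof_fib := by
    intro A B f
    let F := MorphismProperty.factorizationData J.rlp.llp J.rlp f
    refine ⟨F.Z, F.i, F.p, ?_, hJ _ F.hi, F.hp, F.fac⟩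
    exact MorphismProperty.antitone_llp (hI.le.trans inf_le_left) _ F.hi
  factor_cof_trivFib := by
    intro A B f
    let F := MorphismProperty.factorizationData I.rlp.llp I.rlp f
    obtain ⟨h₁, h₂⟩ : (J.rlp ⊓ W) F.p := hI ▸ F.hp
    exact ⟨F.Z, F.i, F.p, F.hi, h₁, h₂, F.fac⟩

attribute [local instance] Cardinal.fact_isRegular_aleph0
  Cardinal.orderBotAleph0OrdToType

lemma isSmallWrt_of_isFinitelyPresentable (T : MorphismProperty C) (A : C)
    [IsFinitelyPresentable.{v} A] : IsSmallWrt T A := by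
  intro F _ c ⟨hc⟩
  have : PreservesColimitsOfShape ℕ (coyoneda.obj (Opposite.op A)) := by
    have := (isCardinalFiltered_aleph0_iff.{v} ℕ).2 inferInstance
    exact preservesColimitsOfShape_of_isCardinalPresentable_of_essentiallySmall A
      Cardinal.aleph0.{v} ℕ
  exact ⟨isColimitOfPreserves _ hc⟩

lemma permitsSOA_of_isFinitelyPresentable (T : MorphismProperty C)
    (hT : ∀ ⦃A B : C⦄ (f : A ⟶ B), T f → IsFinitelyPresentable.{v} A) :
    PermitsSOA {a : Arrow C | T a.hom} := by
  intro a ha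
  have := hT _ ha
  exact isSmallWrt_of_isFinitelyPresentable _ _

lemma hasSmallObjectArgument_of_isFinitelyPresentable [HasColimits C] (T : MorphismProperty C)
    [MorphismProperty.IsSmall.{v} T]
    (hT : ∀ ⦃A B : C⦄ (f : A ⟶ B), T f → IsFinitelyPresentable.{v} A) :
    MorphismProperty.HasSmallObjectArgument.{v} T := by
  have : T.IsCardinalForSmallObjectArgument Cardinal.aleph0.{v} :=
    { preservesColimit := fun i hi _ _ ↦ by
        have := hT _ hi
        infer_instance }
  exact ⟨.aleph0, inferInstance, inferInstance, inferInstance⟩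

lemma rlp_ofHoms_map {D : Type*} [Category* D] {G : C ⥤ D} {L : D ⥤ C} (adj : L ⊣ G)
    {ι : Type*} {A B : ι → D} (i : ∀ k, A k ⟶ B k) {X Y : C} (g : X ⟶ Y) :
    (MorphismProperty.ofHoms (fun k ↦ L.map (i k))).rlp g ↔
      (MorphismProperty.ofHoms i).rlp (G.map g) := by
  constructor
  · rintro h _ _ _ ⟨k⟩
    rw [← adj.hasLiftingProperty_iff]
    exact h _ ⟨k⟩
  · rintro h _ _ _ ⟨k⟩
    rw [adj.hasLiftingProperty_iff]
    exact h _ ⟨k⟩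

lemma llp_rlp_ofHoms_map {D : Type*} [Category* D] (e : C ≌ D)
    {ι : Type*} {A B : ι → D} (i : ∀ k, A k ⟶ B k) {X Y : C} (f : X ⟶ Y) :
    (MorphismProperty.ofHoms (fun k ↦ e.inverse.map (i k))).rlp.llp f ↔
      (MorphismProperty.ofHoms i).rlp.llp (e.functor.map f) := by
  constructor
  · intro h U V g hg
    rw [e.toAdjunction.hasLiftingProperty_iff]
    refine h _ ((rlp_ofHoms_map e.symm.toAdjunction i _).2 ?_)
    exact (MorphismProperty.arrow_mk_iso_iff _ (Arrow.isoMk (e.counitIso.app _)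
      (e.counitIso.app _) (e.counitIso.hom.naturality g).symm)).2 hg
  · intro h U V g hg
    rw [← e.functor.hasLiftingProperty_iff_of_isEquivalence]
    exact h _ ((rlp_ofHoms_map e.symm.toAdjunction i _).1 hg)

end Recognition

section ChainComplex

variable {R : Type u} [Ring R]

/-- An element of a chain complex killed by the differential. -/
def IsCycle (X : ChainComplex (ModuleCat.{u} R) ℕ) {n : ℕ} (x : X.X n) : Prop :=
  ∀ k, X.d n k x = 0

variable {X Y : ChainComplex (ModuleCat.{u} R) ℕ}

lemma d_d_apply (X : ChainComplex (ModuleCat.{u} R) ℕ) (i j k : ℕ) (x : X.X i) :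
    X.d j k (X.d i j x) = 0 := by
  rw [← ConcreteCategory.comp_apply, X.d_comp_d]
  rfl

lemma f_d_apply (g : X ⟶ Y) (i j : ℕ) (x : X.X i) :
    g.f j (X.d i j x) = Y.d i j (g.f i x) := by
  rw [← ConcreteCategory.comp_apply, ← ConcreteCategory.comp_apply, g.comm]

lemma isCycle_of_d_next {n : ℕ} {x : X.X n} (h : X.d n ((ComplexShape.down ℕ).next n) x = 0) :
    IsCycle X x := by
  intro k
  by_cases hk : (ComplexShape.down ℕ).Rel n k
  · obtain rfl := (ComplexShape.down ℕ).next_eq' hk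
    exact h
  · rw [X.shape _ _ hk]
    rfl

lemma isCycle_succ_iff {n : ℕ} {x : X.X (n + 1)} : IsCycle X x ↔ X.d (n + 1) n x = 0 :=
  ⟨fun h ↦ h n, fun h ↦ isCycle_of_d_next (by rwa [ChainComplex.next_nat_succ])⟩

lemma isCycle_zero (x : X.X 0) : IsCycle X x := fun k ↦ by
  rw [X.shape _ _ (by simp)]
  rfl

lemma isCycle_d {n m : ℕ} (x : X.X n) : IsCycle X (X.d n m x) := fun _ ↦ d_d_apply ..

lemma IsCycle.f {n : ℕ} {x : X.X n} (hx : IsCycle X x) (g : X ⟶ Y) : IsCycle Y (g.f n x) :=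
  fun k ↦ by rw [← f_d_apply, hx, map_zero]

/-- The morphism from the free module of rank one given by an element. -/
def homOfElement {M : ModuleCat.{u} R} (x : M) : ModuleCat.of R R ⟶ M :=
  ModuleCat.ofHom (LinearMap.toSpanSingleton R M x)

lemma homOfElement_one {M : ModuleCat.{u} R} (x : M) : homOfElement x (1 : R) = x := by
  simp [homOfElement]

lemma hom_ext_one {M : ModuleCat.{u} R} {f g : ModuleCat.of R R ⟶ M}
    (h : f (1 : R) = g (1 : R)) : f = g := by
  ext
  exact h

lemma homOfElement_comp {M N : ModuleCat.{u} R} (x : M) (f : M ⟶ N) :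
    homOfElement x ≫ f = homOfElement (f x) :=
  hom_ext_one ((congrArg f (homOfElement_one x)).trans (homOfElement_one (f x)).symm)

lemma homOfElement_zero (M : ModuleCat.{u} R) : homOfElement (0 : M) = 0 :=
  hom_ext_one (homOfElement_one 0)

lemma exists_epi_comp_eq {A M N : ModuleCat.{u} R} (x : A ⟶ M) (f : N ⟶ M)
    (h : ∀ a, ∃ n, f n = x a) :
    ∃ (A' : ModuleCat.{u} R) (π : A' ⟶ A) (_ : Epi π) (y : A' ⟶ N), π ≫ x = y ≫ f := by
  let S : Submodule R (A × N) :=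
    LinearMap.ker ((x.hom.comp (LinearMap.fst R A N)) - f.hom.comp (LinearMap.snd R A N))
  refine ⟨ModuleCat.of R S, ModuleCat.ofHom ((LinearMap.fst R A N).comp S.subtype), ?_,
    ModuleCat.ofHom ((LinearMap.snd R A N).comp S.subtype), ?_⟩
  · rw [ModuleCat.epi_iff_surjective]
    intro a
    obtain ⟨n, hn⟩ := h a
    exact ⟨⟨(a, n), by simp [S, hn]⟩, rfl⟩
  · ext ⟨⟨a, n⟩, hs⟩
    simpa [S, sub_eq_zero] using hs

lemma mono_homologyMap_iff (g : X ⟶ Y) (n : ℕ) :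
    Mono (HomologicalComplex.homologyMap g n) ↔
      ∀ (x : X.X n) (y : Y.X (n + 1)), IsCycle X x → g.f n x = Y.d (n + 1) n y →
        ∃ x', X.d (n + 1) n x' = x := by
  rw [HomologicalComplex.mono_homologyMap_iff_up_to_refinements g (n + 1) n _ (by simp) rfl]
  constructor
  · intro h x y hx hy
    obtain ⟨A', π, _, x₁, hx₁⟩ := h (homOfElement x)
      (by rw [homOfElement_comp, hx, homOfElement_zero]) (homOfElement y)
      (by rw [homOfElement_comp, homOfElement_comp, hy])
    obtain ⟨a, ha⟩ := (ModuleCat.epi_iff_surjective π).1 inferInstance (1 : R)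
    refine ⟨x₁ a, ?_⟩
    rw [← homOfElement_one x, ← ha]
    exact (ConcreteCategory.congr_hom hx₁ a).symm
  · intro h A x₂ hx₂ y₁ hy₁
    refine exists_epi_comp_eq x₂ _ fun a ↦ h _ (y₁ a) (isCycle_of_d_next ?_) ?_
    · exact ConcreteCategory.congr_hom hx₂ a
    · exact ConcreteCategory.congr_hom hy₁ a

lemma epi_homologyMap_iff (g : X ⟶ Y) (n : ℕ) :
    Epi (HomologicalComplex.homologyMap g n) ↔
      ∀ (y : Y.X n), IsCycle Y y →
        ∃ (x : X.X n) (y' : Y.X (n + 1)), IsCycle X x ∧ y = g.f n x + Y.d (n + 1) n y' := by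
  rw [HomologicalComplex.epi_homologyMap_iff_up_to_refinements g (n + 1) n _ (by simp) rfl]
  constructor
  · intro h y hy
    obtain ⟨A', π, _, x₂, hx₂, y₁, hy₁⟩ := h (homOfElement y)
      (by rw [homOfElement_comp, hy, homOfElement_zero])
    obtain ⟨a, ha⟩ := (ModuleCat.epi_iff_surjective π).1 inferInstance (1 : R)
    refine ⟨x₂ a, y₁ a, isCycle_of_d_next (ConcreteCategory.congr_hom hx₂ a), ?_⟩
    refine (homOfElement_one y).symm.trans ?_
    rw [← ha]
    exact ConcreteCategory.congr_hom hy₁ a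
  · intro h A y₂ hy₂
    let Z := ModuleCat.of R (LinearMap.ker (X.d n ((ComplexShape.down ℕ).next n)).hom)
    let z : Z ⟶ X.X n := ModuleCat.ofHom (Submodule.subtype _)
    let F : ModuleCat.of R (Z × Y.X (n + 1)) ⟶ Y.X n := ModuleCat.ofHom
      ((z ≫ g.f n).hom.comp (LinearMap.fst R Z (Y.X (n + 1))) +
        (Y.d (n + 1) n).hom.comp (LinearMap.snd R Z (Y.X (n + 1))))
    obtain ⟨A', π, hπ, w, hw⟩ := exists_epi_comp_eq y₂ F fun a ↦ by
      obtain ⟨x, y', hx, h'⟩ := h (y₂ a) (isCycle_of_d_next (ConcreteCategory.congr_hom hy₂ a))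
      exact ⟨(⟨x, hx _⟩, y'), h'.symm⟩
    refine ⟨A', π, hπ, w ≫ ModuleCat.ofHom (LinearMap.fst R Z (Y.X (n + 1))) ≫ z, ?_,
      w ≫ ModuleCat.ofHom (LinearMap.snd R Z (Y.X (n + 1))), ?_⟩
    · ext a
      exact (w a).1.2
    · rw [hw]
      rfl

lemma quasiIso_iff_elements (g : X ⟶ Y) :
    QuasiIso g ↔ ∀ n,
      (∀ (x : X.X n) (y : Y.X (n + 1)), IsCycle X x → g.f n x = Y.d (n + 1) n y →
        ∃ x', X.d (n + 1) n x' = x) ∧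
      ∀ (y : Y.X n), IsCycle Y y →
        ∃ (x : X.X n) (y' : Y.X (n + 1)), IsCycle X x ∧ y = g.f n x + Y.d (n + 1) n y' := by
  simp_rw [quasiIso_iff, quasiIsoAt_iff_isIso_homologyMap, ← mono_homologyMap_iff,
    ← epi_homologyMap_iff]
  exact forall_congr' fun n ↦ ⟨fun _ ↦ ⟨inferInstance, inferInstance⟩,
    fun ⟨_, _⟩ ↦ isIso_of_mono_of_epi _⟩

/-- The lifting condition against the inclusions of spheres into disks, on elements. -/
structure LiftsDisks (g : X ⟶ Y) : Prop where
  surjective_zero : Function.Surjective (g.f 0)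
  exists_lift (n : ℕ) (x : X.X n) (y : Y.X (n + 1)) (hx : IsCycle X x)
    (hxy : Y.d (n + 1) n y = g.f n x) : ∃ x', X.d (n + 1) n x' = x ∧ g.f (n + 1) x' = y

lemma LiftsDisks.exists_cycle {g : X ⟶ Y} (hg : LiftsDisks g) :
    ∀ {n : ℕ} (y : Y.X n), IsCycle Y y → ∃ x, IsCycle X x ∧ g.f n x = y
  | 0, y, _ => by
    obtain ⟨x, hx⟩ := hg.surjective_zero y
    exact ⟨x, isCycle_zero x, hx⟩
  | n + 1, y, hy => by
    obtain ⟨x, h₁, h₂⟩ := hg.exists_lift n 0 y (fun _ ↦ map_zero _) (by rw [hy, map_zero])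
    exact ⟨x, isCycle_succ_iff.2 h₁, h₂⟩

lemma LiftsDisks.surjective {g : X ⟶ Y} (hg : LiftsDisks g) : ∀ n, Function.Surjective (g.f n)
  | 0 => hg.surjective_zero
  | n + 1 => fun y ↦ by
    obtain ⟨x, hx, h⟩ := hg.exists_cycle (Y.d (n + 1) n y) (isCycle_d y)
    obtain ⟨x', -, h'⟩ := hg.exists_lift n x y hx h.symm
    exact ⟨x', h'⟩

lemma liftsDisks_iff (g : X ⟶ Y) :
    LiftsDisks g ↔ (∀ i, 1 ≤ i → Function.Surjective (g.f i)) ∧ QuasiIso g := by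
  rw [quasiIso_iff_elements]
  constructor
  · refine fun hg ↦ ⟨fun i _ ↦ hg.surjective i, fun n ↦ ⟨fun x y hx hy ↦ ?_, fun y hy ↦ ?_⟩⟩
    · obtain ⟨x', h, -⟩ := hg.exists_lift n x y hx hy.symm
      exact ⟨x', h⟩
    · obtain ⟨x, hx, rfl⟩ := hg.exists_cycle y hy
      exact ⟨x, 0, hx, by simp⟩
  · rintro ⟨hs, hq⟩
    constructor
    · intro y
      obtain ⟨x, y', -, rfl⟩ := (hq 0).2 y (isCycle_zero y)
      obtain ⟨x', rfl⟩ := hs _ le_rfl y'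
      exact ⟨x + X.d 1 0 x', by rw [map_add, f_d_apply]⟩
    · intro n x y hx hxy
      obtain ⟨x₁, rfl⟩ := (hq n).1 x y hx hxy.symm
      obtain ⟨x₂, y', hx₂, h⟩ := (hq (n + 1)).2 (y - g.f (n + 1) x₁) (isCycle_succ_iff.2
        (by rw [map_sub, hxy, f_d_apply, sub_self]))
      obtain ⟨x₃, rfl⟩ := hs (n + 2) (by lia) y'
      refine ⟨x₁ + (x₂ + X.d (n + 2) (n + 1) x₃), ?_, ?_⟩
      · rw [map_add, map_add, hx₂, d_d_apply, add_zero, add_zero]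
      · rw [map_add, map_add, f_d_apply, ← h, add_sub_cancel]

end ChainComplex

section Generators

open HomologicalComplex

section Double

variable {D : Type*} [Category* D] [HasZeroMorphisms D] [HasZeroObject D] {X₀ X₁ : D}

open scoped Classical in
/-- Constructor for morphisms to a homological complex `double f hi₀₁`. -/
noncomputable def mkHomToDouble {f : X₀ ⟶ X₁} {ι : Type*} {c : ComplexShape ι} {i₀ i₁ : ι}
    (hi₀₁ : c.Rel i₀ i₁) (h : i₀ ≠ i₁) {K : HomologicalComplex D c}
    (φ₀ : K.X i₀ ⟶ X₀) (φ₁ : K.X i₁ ⟶ X₁) (comm : K.d i₀ i₁ ≫ φ₁ = φ₀ ≫ f)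
    (hφ : ∀ k, c.Rel k i₀ → K.d k i₀ ≫ φ₀ = 0) : K ⟶ double f hi₀₁ where
  f k :=
    if hk₀ : k = i₀ then
      eqToHom (by rw [hk₀]) ≫ φ₀ ≫ (doubleXIso₀ f hi₀₁).inv ≫ eqToHom (by rw [hk₀])
    else if hk₁ : k = i₁ then
      eqToHom (by rw [hk₁]) ≫ φ₁ ≫ (doubleXIso₁ f hi₀₁ h).inv ≫ eqToHom (by rw [hk₁])
    else 0
  comm' k₀ k₁ hk := by
    by_cases h₁ : k₁ = i₁
    · subst h₁
      rw [dif_neg h.symm, dif_pos rfl]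
      obtain rfl := c.prev_eq hk hi₀₁
      simp [double_d f hi₀₁ h, reassoc_of% comm]
    · by_cases h₀ : k₁ = i₀
      · subst h₀
        rw [dif_pos rfl]
        simp [reassoc_of% (hφ _ hk), double_d_eq_zero₁ f hi₀₁ _ _ h]
      · apply (isZero_double_X f hi₀₁ k₁ h₀ h₁).eq_of_tgt

variable {f : X₀ ⟶ X₁} {ι : Type*} {c : ComplexShape ι} {i₀ i₁ : ι}
    (hi₀₁ : c.Rel i₀ i₁) (h : i₀ ≠ i₁) {K : HomologicalComplex D c}
    (φ₀ : K.X i₀ ⟶ X₀) (φ₁ : K.X i₁ ⟶ X₁) (comm : K.d i₀ i₁ ≫ φ₁ = φ₀ ≫ f)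
    (hφ : ∀ k, c.Rel k i₀ → K.d k i₀ ≫ φ₀ = 0)

@[simp]
lemma mkHomToDouble_f₀ :
    (mkHomToDouble hi₀₁ h φ₀ φ₁ comm hφ).f i₀ = φ₀ ≫ (doubleXIso₀ f hi₀₁).inv := by
  simp [mkHomToDouble]

@[simp]
lemma mkHomToDouble_f₁ :
    (mkHomToDouble hi₀₁ h φ₀ φ₁ comm hφ).f i₁ = φ₁ ≫ (doubleXIso₁ f hi₀₁ h).inv := by
  simp [mkHomToDouble, h.symm]

end Double

variable {R : Type u} [Ring R]

lemma down_rel (n : ℕ) : (ComplexShape.down ℕ).Rel (n + 1) n := by simp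

/-- The complex with the identity of `M` from degree `n + 1` to degree `n`. -/
noncomputable abbrev disk (n : ℕ) (M : ModuleCat.{u} R) : ChainComplex (ModuleCat.{u} R) ℕ :=
  double (𝟙 M) (down_rel n)

/-- The complex with `M` in degree `n`. -/
noncomputable abbrev sphere (n : ℕ) (M : ModuleCat.{u} R) : ChainComplex (ModuleCat.{u} R) ℕ :=
  (single (ModuleCat.{u} R) (ComplexShape.down ℕ) n).obj M

/-- The inclusion of the boundary of a disk. -/
noncomputable def sphereToDisk (n : ℕ) (M : ModuleCat.{u} R) : sphere n M ⟶ disk n M :=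
  mkHomFromSingle (doubleXIso₁ (𝟙 M) (down_rel n) (by simp)).inv (fun k _ ↦ by
    rw [double_d_eq_zero₀ _ _ _ _ (by simp), comp_zero])

variable {X Y : ChainComplex (ModuleCat.{u} R) ℕ}

/-- The morphism from a disk given by an element. -/
noncomputable def diskHom {n : ℕ} (x : X.X (n + 1)) : disk n (ModuleCat.of R R) ⟶ X :=
  mkHomFromDouble (down_rel n) (by simp) (homOfElement x) (homOfElement x ≫ X.d _ _) (by simp)
    (by simp)

/-- The morphism from a sphere given by a cycle. -/
noncomputable def sphereHom {n : ℕ} (x : X.X n) (hx : IsCycle X x) :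
    sphere n (ModuleCat.of R R) ⟶ X :=
  mkHomFromSingle (homOfElement x) (fun k _ ↦ by
    rw [homOfElement_comp, hx, homOfElement_zero])

lemma exists_eq_homOfElement {M : ModuleCat.{u} R} (φ : ModuleCat.of R R ⟶ M) :
    ∃ x, φ = homOfElement x :=
  ⟨φ (1 : R), hom_ext_one (homOfElement_one _).symm⟩

lemma exists_diskHom {n : ℕ} (u : disk n (ModuleCat.of R R) ⟶ X) : ∃ x, u = diskHom x := by
  obtain ⟨x, hx⟩ := exists_eq_homOfElement
    ((doubleXIso₀ (𝟙 (ModuleCat.of R R)) (down_rel n)).inv ≫ u.f (n + 1))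
  refine ⟨x, ?_⟩
  apply from_double_hom_ext
  · simp [diskHom, ← hx]
  · simp [diskHom, ← hx, double_d]

lemma exists_sphereHom {n : ℕ} (u : sphere n (ModuleCat.of R R) ⟶ X) :
    ∃ x hx, u = sphereHom x hx := by
  obtain ⟨x, hx⟩ := exists_eq_homOfElement
    ((singleObjXSelf (ComplexShape.down ℕ) n (ModuleCat.of R R)).inv ≫ u.f n)
  refine ⟨x, fun k ↦ ?_, ?_⟩
  · have : homOfElement x ≫ X.d n k = 0 := by simp [← hx]
    rw [homOfElement_comp] at this
    exact (homOfElement_one _).symm.trans (ConcreteCategory.congr_hom this (1 : R))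
  · apply from_single_hom_ext
    simp [sphereHom, ← hx]

lemma diskHom_comp {n : ℕ} (x : X.X (n + 1)) (g : X ⟶ Y) :
    diskHom x ≫ g = diskHom (g.f (n + 1) x) := by
  apply from_double_hom_ext <;> simp [diskHom, homOfElement_comp, f_d_apply]

lemma sphereHom_comp {n : ℕ} (x : X.X n) (hx : IsCycle X x) (g : X ⟶ Y) :
    sphereHom x hx ≫ g = sphereHom (g.f n x) (hx.f g) := by
  apply from_single_hom_ext
  simp [sphereHom, homOfElement_comp]

lemma sphereToDisk_comp_diskHom {n : ℕ} (x : X.X (n + 1)) :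
    sphereToDisk n (ModuleCat.of R R) ≫ diskHom x = sphereHom (X.d (n + 1) n x) (isCycle_d x) := by
  apply from_single_hom_ext
  simp [sphereHom, diskHom, sphereToDisk, homOfElement_comp]

lemma homOfElement_injective {M : ModuleCat.{u} R} {x y : M}
    (h : homOfElement x = homOfElement y) : x = y := by
  rw [← homOfElement_one x, h, homOfElement_one]

lemma diskHom_injective {n : ℕ} {x y : X.X (n + 1)} (h : diskHom x = diskHom y) : x = y := by
  have := congr_hom h (n + 1)
  simp only [diskHom, mkHomFromDouble_f₀, cancel_epi] at this
  exact homOfElement_injective this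

lemma sphereHom_injective {n : ℕ} {x y : X.X n} {hx : IsCycle X x} {hy : IsCycle X y}
    (h : sphereHom x hx = sphereHom y hy) : x = y := by
  have := congr_hom h n
  simp only [sphereHom, mkHomFromSingle_f, cancel_epi] at this
  exact homOfElement_injective this

open scoped ZeroObject

lemma hasLiftingProperty_zero_sphere_iff (g : X ⟶ Y) :
    HasLiftingProperty (0 : 0 ⟶ sphere 0 (ModuleCat.of R R)) g ↔
      Function.Surjective (g.f 0) := by
  constructor
  · intro _ y
    have sq : CommSq 0 (0 : 0 ⟶ sphere 0 (ModuleCat.of R R)) g (sphereHom y (isCycle_zero y)) :=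
      ⟨by simp⟩
    obtain ⟨x, hx, h⟩ := exists_sphereHom sq.lift
    refine ⟨x, sphereHom_injective (hy := isCycle_zero y) ((sphereHom_comp x hx g).symm.trans ?_)⟩
    rw [← h, sq.fac_right]
  · refine fun hg ↦ ⟨fun {u v} sq ↦ ?_⟩
    obtain ⟨y, hy, rfl⟩ := exists_sphereHom v
    obtain ⟨x, rfl⟩ := hg y
    exact ⟨⟨⟨sphereHom x (isCycle_zero x), (isZero_zero _).eq_of_src _ _,
      sphereHom_comp _ _ _⟩⟩⟩

lemma hasLiftingProperty_zero_disk_iff (g : X ⟶ Y) (n : ℕ) :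
    HasLiftingProperty (0 : 0 ⟶ disk n (ModuleCat.of R R)) g ↔
      Function.Surjective (g.f (n + 1)) := by
  constructor
  · intro _ y
    have sq : CommSq 0 (0 : 0 ⟶ disk n (ModuleCat.of R R)) g (diskHom y) := ⟨by simp⟩
    obtain ⟨x, h⟩ := exists_diskHom sq.lift
    refine ⟨x, diskHom_injective ((diskHom_comp x g).symm.trans ?_)⟩
    rw [← h, sq.fac_right]
  · refine fun hg ↦ ⟨fun {u v} sq ↦ ?_⟩
    obtain ⟨y, rfl⟩ := exists_diskHom v
    obtain ⟨x, rfl⟩ := hg y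
    exact ⟨⟨⟨diskHom x, (isZero_zero _).eq_of_src _ _, diskHom_comp _ _⟩⟩⟩

lemma hasLiftingProperty_sphereToDisk_iff (g : X ⟶ Y) (n : ℕ) :
    HasLiftingProperty (sphereToDisk n (ModuleCat.of R R)) g ↔
      ∀ (x : X.X n) (y : Y.X (n + 1)), IsCycle X x → Y.d (n + 1) n y = g.f n x →
        ∃ x', X.d (n + 1) n x' = x ∧ g.f (n + 1) x' = y := by
  constructor
  · intro _ x y hx hxy
    have sq : CommSq (sphereHom x hx) (sphereToDisk n (ModuleCat.of R R)) g (diskHom y) := ⟨by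
      simp only [sphereHom_comp, sphereToDisk_comp_diskHom, hxy]⟩
    obtain ⟨x', h⟩ := exists_diskHom sq.lift
    refine ⟨x', sphereHom_injective (hy := hx) ((sphereToDisk_comp_diskHom x').symm.trans ?_),
      diskHom_injective ((diskHom_comp x' g).symm.trans ?_)⟩
    · rw [← h, sq.fac_left]
    · rw [← h, sq.fac_right]
  · refine fun hg ↦ ⟨fun {u v} sq ↦ ?_⟩
    obtain ⟨x, hx, rfl⟩ := exists_sphereHom u
    obtain ⟨y, rfl⟩ := exists_diskHom v
    have := sq.w
    rw [sphereHom_comp, sphereToDisk_comp_diskHom] at this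
    obtain ⟨x', rfl, rfl⟩ := hg x y hx (sphereHom_injective this).symm
    exact ⟨⟨⟨diskHom x', sphereToDisk_comp_diskHom _, diskHom_comp _ _⟩⟩⟩

variable (R) in
/-- The sources of the generating cofibrations. -/
noncomputable def boundary : ℕ → ChainComplex (ModuleCat.{u} R) ℕ
  | 0 => 0
  | n + 1 => sphere n (ModuleCat.of R R)

variable (R) in
/-- The targets of the generating cofibrations. -/
noncomputable def cell : ℕ → ChainComplex (ModuleCat.{u} R) ℕ
  | 0 => sphere 0 (ModuleCat.of R R)
  | n + 1 => disk n (ModuleCat.of R R)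

variable (R) in
/-- The generating cofibrations. -/
noncomputable def boundaryInclusion : ∀ n, boundary R n ⟶ cell R n
  | 0 => 0
  | n + 1 => sphereToDisk n (ModuleCat.of R R)

variable (R) in
/-- The generating trivial cofibrations. -/
noncomputable def zeroToDisk (n : ℕ) :
    (0 : ChainComplex (ModuleCat.{u} R) ℕ) ⟶ disk n (ModuleCat.of R R) := 0

lemma rlp_boundaryInclusion_iff (g : X ⟶ Y) :
    (MorphismProperty.ofHoms (boundaryInclusion R)).rlp g ↔ LiftsDisks g := by
  constructor
  · intro h
    exact ⟨(hasLiftingProperty_zero_sphere_iff g).1 (h _ ⟨0⟩), fun n ↦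
      (hasLiftingProperty_sphereToDisk_iff g n).1 (h _ ⟨n + 1⟩)⟩
  · rintro h _ _ _ ⟨_ | n⟩
    · exact (hasLiftingProperty_zero_sphere_iff g).2 h.surjective_zero
    · exact (hasLiftingProperty_sphereToDisk_iff g n).2 (h.exists_lift n)

lemma rlp_zeroToDisk_iff (g : X ⟶ Y) :
    (MorphismProperty.ofHoms (zeroToDisk R)).rlp g ↔
      ∀ i, 1 ≤ i → Function.Surjective (g.f i) := by
  constructor
  · rintro h (_ | n) hn
    · simp at hn
    · exact (hasLiftingProperty_zero_disk_iff g n).1 (h _ ⟨n⟩)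
  · rintro h _ _ _ ⟨n⟩
    exact (hasLiftingProperty_zero_disk_iff g n).2 (h _ (by simp))

end Generators

section Presentable

open HomologicalComplex
open scoped ZeroObject

variable {R : Type u} [Ring R] {X Y : ChainComplex (ModuleCat.{u} R) ℕ}

attribute [local instance] Cardinal.fact_isRegular_aleph0

lemma isFinitelyPresentable_of_isColimit {C : Type*} [Category.{v} C] {K : Type} [SmallCategory K]
    [FinCategory K] {F : K ⥤ C} (c : Cocone F) (hc : IsColimit c)
    (hF : ∀ k, IsFinitelyPresentable.{v} (F.obj k)) : IsFinitelyPresentable.{v} c.pt :=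
  isCardinalPresentable_of_isColimit' c hc _ (by
    rw [hasCardinalLT_aleph0_iff, Arrow.finite_iff]
    exact ⟨inferInstance⟩)

lemma isFinitelyPresentable_of_isZero {C : Type*} [Category.{v} C] {X : C} (hX : IsZero X) :
    IsFinitelyPresentable.{v} X :=
  isFinitelyPresentable_of_isColimit (asEmptyCocone X) hX.isInitial (by rintro ⟨⟨⟩⟩)

instance : IsFinitelyPresentable.{u} (ModuleCat.of R R) := by
  let e : CategoryTheory.forget (ModuleCat.{u} R) ≅ coyoneda.obj (Opposite.op (ModuleCat.of R R)) :=
    NatIso.ofComponents (fun M ↦ Equiv.toIso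
      { toFun x := homOfElement x
        invFun φ := ConcreteCategory.hom (C := ModuleCat.{u} R) φ (1 : R)
        left_inv x := homOfElement_one x
        right_inv φ := hom_ext_one (homOfElement_one _) })
      fun f ↦ by
        ext x
        exact (homOfElement_comp x f).symm
  rw [isFinitelyPresentable_iff_preservesFilteredColimits]
  exact ⟨fun J _ _ ↦ preservesColimitsOfShape_of_natIso e⟩

lemma isFinitelyPresentable_of_corepresentableBy_eval {Z : ChainComplex (ModuleCat.{u} R) ℕ}
    {n : ℕ}
    (h : (eval _ _ n ⋙ coyoneda.obj (Opposite.op (ModuleCat.of R R))).CorepresentableBy Z) :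
    IsFinitelyPresentable.{u} Z := by
  have : PreservesColimitsOfSize.{u, u}
      (eval (ModuleCat.{u} R) (ComplexShape.down ℕ) n) := ⟨inferInstance⟩
  have : IsFinitelyPresentable.{u} (ModuleCat.of R R) := inferInstance
  have : (eval (ModuleCat.{u} R) (ComplexShape.down ℕ) n ⋙ coyoneda.obj
      (Opposite.op (ModuleCat.of R R))).IsCardinalAccessible Cardinal.aleph0.{u} := inferInstance
  exact Functor.isCardinalAccessible_of_natIso h.toIso.symm Cardinal.aleph0.{u}

instance (n : ℕ) : IsFinitelyPresentable.{u} (disk n (ModuleCat.of R R)) :=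
  isFinitelyPresentable_of_corepresentableBy_eval
    (evalCompCoyonedaCorepresentableByDoubleId (down_rel n) (by simp) _)

lemma sphereHom_zero {n : ℕ} : sphereHom (0 : X.X n) (fun _ ↦ map_zero _) = 0 := by
  apply from_single_hom_ext
  simp [sphereHom, homOfElement_zero]

/-- The projection from a disk to the top dimensional sphere. -/
noncomputable def diskToSphere (n : ℕ) :
    disk n (ModuleCat.of R R) ⟶ sphere (n + 1) (ModuleCat.of R R) :=
  diskHom ((singleObjXSelf (ComplexShape.down ℕ) (n + 1) (ModuleCat.of R R)).inv (1 : R))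

lemma sphereToDisk_comp_diskToSphere (n : ℕ) :
    sphereToDisk n (ModuleCat.of R R) ≫ diskToSphere n = 0 := by
  apply from_single_hom_ext
  exact (isZero_single_obj_X _ _ _ _ (by simp)).eq_of_tgt _ _

lemma diskToSphere_comp_sphereHom {n : ℕ} (x : X.X (n + 1)) (hx : IsCycle X x) :
    diskToSphere n ≫ sphereHom x hx = diskHom x := by
  rw [diskToSphere, diskHom_comp]
  congr 1
  rw [← ConcreteCategory.comp_apply]
  simp only [sphereHom, mkHomFromSingle_f, Iso.inv_hom_id_assoc]
  exact homOfElement_one x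

lemma exists_diskToSphere_comp_eq {n : ℕ} (u : disk n (ModuleCat.of R R) ⟶ X)
    (hu : sphereToDisk n _ ≫ u = 0) : ∃ v, diskToSphere n ≫ v = u := by
  obtain ⟨x, rfl⟩ := exists_diskHom u
  rw [sphereToDisk_comp_diskHom, ← sphereHom_zero] at hu
  exact ⟨_, diskToSphere_comp_sphereHom x (isCycle_succ_iff.2 (sphereHom_injective hu))⟩

instance (n : ℕ) : Epi (diskToSphere (R := R) n) where
  left_cancellation u v h := by
    obtain ⟨x, hx, rfl⟩ := exists_sphereHom u
    obtain ⟨y, hy, rfl⟩ := exists_sphereHom v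
    simp only [diskToSphere_comp_sphereHom] at h
    simp only [diskHom_injective h]

instance (n : ℕ) : IsFinitelyPresentable.{u} (sphere n (ModuleCat.of R R)) := by
  induction n with
  | zero =>
    exact isFinitelyPresentable_of_corepresentableBy_eval
      (evalCompCoyonedaCorepresentableBySingle _ 0 (by simp) _)
  | succ n hn =>
    refine isFinitelyPresentable_of_isColimit _
      (CokernelCofork.IsColimit.ofπ (diskToSphere n) (sphereToDisk_comp_diskToSphere n)
        (fun u hu ↦ (exists_diskToSphere_comp_eq u hu).choose)
        (fun u hu ↦ (exists_diskToSphere_comp_eq u hu).choose_spec)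
        (fun u hu v hv ↦ ?_)) ?_
    · rw [← cancel_epi (diskToSphere n), hv, (exists_diskToSphere_comp_eq u hu).choose_spec]
    · rintro (_ | _)
      · exact hn
      · exact inferInstanceAs (IsFinitelyPresentable.{u} (disk n (ModuleCat.of R R)))

instance (n : ℕ) : IsFinitelyPresentable.{u} (boundary R n) :=
  match n with
  | 0 => isFinitelyPresentable_of_isZero (isZero_zero _)
  | n + 1 => inferInstanceAs (IsFinitelyPresentable.{u} (sphere n (ModuleCat.of R R)))

instance : IsFinitelyPresentable.{u} (0 : ChainComplex (ModuleCat.{u} R) ℕ) :=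
  isFinitelyPresentable_of_isZero (isZero_zero _)

end Presentable

section Cofibrations

open HomologicalComplex MorphismProperty
open scoped ZeroObject

lemma llp_epimorphisms_iff {C : Type*} [Category* C] [Abelian C] {A B : C} (i : A ⟶ B) :
    (epimorphisms C).llp i ↔ Mono i ∧ Projective (cokernel i) := by
  constructor
  · intro h
    constructor
    · have := h (0 : A ⟶ 0) (inferInstanceAs (Epi _))
      have sq : CommSq (𝟙 A) i (0 : A ⟶ 0) 0 := ⟨by simp⟩
      exact mono_of_mono_fac sq.fac_left
    · constructor
      intro E F w p hp
      have := h p hp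
      have sq : CommSq 0 i p (cokernel.π i ≫ w) := ⟨by simp⟩
      exact ⟨cokernel.desc i sq.lift sq.fac_left, by
        rw [← cancel_epi (cokernel.π i), cokernel.π_desc_assoc, sq.fac_right]⟩
  · rintro ⟨_, _⟩ E F p (_ : Epi p)
    let S := ShortComplex.mk i (cokernel.π i) (by simp)
    have : Projective S.X₃ := inferInstanceAs (Projective (cokernel i))
    have hS : S.ShortExact := { exact := S.exact_of_g_is_cokernel (cokernelIsCokernel i) }
    have σ := hS.splittingOfProjective
    have h₁ : i ≫ σ.r = 𝟙 A := σ.f_r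
    refine ⟨fun {u v} sq ↦ ?_⟩
    let w : cokernel i ⟶ F := cokernel.desc i (v - σ.r ≫ u ≫ p) (by
      rw [Preadditive.comp_sub, reassoc_of% h₁, sq.w, sub_self])
    refine ⟨⟨σ.r ≫ u + cokernel.π i ≫ Projective.factorThru w p, ?_, ?_⟩⟩
    · simp [reassoc_of% h₁]
    · simp [w]

variable {R : Type u} [Ring R] {A B X Y : ChainComplex (ModuleCat.{u} R) ℕ}

/-- The morphism to a disk given by a morphism in the lower degree. -/
noncomputable def toDisk {n : ℕ} {K : ChainComplex (ModuleCat.{u} R) ℕ} {M : ModuleCat.{u} R}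
    (φ : K.X n ⟶ M) : K ⟶ disk n M :=
  mkHomToDouble (down_rel n) (by simp) (K.d (n + 1) n ≫ φ) φ (by simp) (by simp)

lemma toDisk_f {n : ℕ} {K : ChainComplex (ModuleCat.{u} R) ℕ} {M : ModuleCat.{u} R}
    (φ : K.X n ⟶ M) : (toDisk φ).f n = φ ≫ (doubleXIso₁ (𝟙 M) (down_rel n) (by simp)).inv := by
  simp [toDisk]

lemma toDisk_f_succ {n : ℕ} {K : ChainComplex (ModuleCat.{u} R) ℕ} {M : ModuleCat.{u} R}
    (φ : K.X n ⟶ M) :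
    (toDisk φ).f (n + 1) = K.d (n + 1) n ≫ φ ≫ (doubleXIso₀ (𝟙 M) (down_rel n)).inv := by
  simp [toDisk]

/-- Morphisms to a disk are morphisms to its module in the lower degree. -/
noncomputable def toDiskEquiv (n : ℕ) (K : ChainComplex (ModuleCat.{u} R) ℕ)
    (M : ModuleCat.{u} R) : (K.X n ⟶ M) ≃ (K ⟶ disk n M) where
  toFun φ := toDisk φ
  invFun ψ := ψ.f n ≫ (doubleXIso₁ (𝟙 M) (down_rel n) (by simp)).hom
  left_inv φ := by simp [toDisk_f]
  right_inv ψ := by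
    apply to_double_hom_ext
    · simp [toDisk_f_succ, ← Hom.comm_assoc, double_d]
    · simp [toDisk_f]

lemma comp_toDisk {n : ℕ} {K K' : ChainComplex (ModuleCat.{u} R) ℕ} {M : ModuleCat.{u} R}
    (f : K' ⟶ K) (φ : K.X n ⟶ M) : f ≫ toDisk φ = toDisk (f.f n ≫ φ) := by
  apply to_double_hom_ext <;> simp [toDisk_f, toDisk_f_succ]

variable (R) in
/-- The right adjoint of the evaluation in some degree. -/
noncomputable def diskFunctor (n : ℕ) : ModuleCat.{u} R ⥤ ChainComplex (ModuleCat.{u} R) ℕ :=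
  Adjunction.rightAdjointOfEquiv
    (F := HomologicalComplex.eval (ModuleCat.{u} R) (ComplexShape.down ℕ) n)
    (toDiskEquiv n) (fun _ _ _ f φ ↦ (comp_toDisk f φ).symm)

variable (R) in
/-- The evaluation in some degree is left adjoint to the disk functor. -/
noncomputable def evalAdjunction (n : ℕ) :
    HomologicalComplex.eval (ModuleCat.{u} R) (ComplexShape.down ℕ) n ⊣ diskFunctor R n :=
  Adjunction.adjunctionOfEquivRight _ _

instance : Projective (ModuleCat.of R R) :=
  (IsProjective.iff_projective R).1 inferInstance

lemma projective_sphere_X (k n : ℕ) : Projective ((sphere k (ModuleCat.of R R)).X n) := by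
  by_cases h : n = k
  · subst h
    exact .of_iso (singleObjXSelf _ n (ModuleCat.of R R)).symm inferInstance
  · exact (isZero_single_obj_X _ _ _ _ h).projective

lemma projective_disk_X (k n : ℕ) : Projective ((disk k (ModuleCat.of R R)).X n) := by
  by_cases h₀ : n = k + 1
  · subst h₀
    exact .of_iso (doubleXIso₀ _ _).symm inferInstance
  · by_cases h₁ : n = k
    · subst h₁
      exact .of_iso (doubleXIso₁ _ _ (by simp)).symm inferInstance
    · exact (isZero_double_X _ _ _ h₀ h₁).projective

lemma llp_epimorphisms_boundaryInclusion (k n : ℕ) :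
    (epimorphisms (ModuleCat.{u} R)).llp ((boundaryInclusion R k).f n) := by
  rcases k with _ | k
  · have := projective_sphere_X (R := R) 0 n
    exact (projective_iff_llp_epimorphisms_of_isZero _
      ((HomologicalComplex.eval _ _ n).map_isZero (isZero_zero _))).1 this
  · by_cases h : n = k
    · subst h
      have : IsIso ((sphereToDisk n (ModuleCat.of R R)).f n) := by
        simp only [sphereToDisk, mkHomFromSingle_f]
        infer_instance
      intro _ _ p _
      exact inferInstanceAs (HasLiftingProperty ((sphereToDisk n (ModuleCat.of R R)).f n) p)
    · have := projective_disk_X (R := R) k n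
      exact (projective_iff_llp_epimorphisms_of_isZero _ (isZero_single_obj_X _ _ _ _ h)).1 this

lemma liftsDisks_map_diskFunctor (n : ℕ) {E F : ModuleCat.{u} R} (p : E ⟶ F) [Epi p] :
    LiftsDisks ((diskFunctor R n).map p) := by
  rw [← rlp_boundaryInclusion_iff]
  rintro _ _ _ ⟨k⟩
  rw [← (evalAdjunction R n).hasLiftingProperty_iff]
  exact llp_epimorphisms_boundaryInclusion k n p (inferInstanceAs (Epi p))

lemma exists_lift_of_forall_exists {A B E F : ModuleCat.{u} R} (i : A ⟶ B)
    (hi : (epimorphisms _).llp i) (p : E ⟶ F) (u : A ⟶ E) (v : B ⟶ F) (w : i ≫ v = u ≫ p)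
    (h : ∀ b, ∃ e, p e = v b) : ∃ l : B ⟶ E, i ≫ l = u ∧ l ≫ p = v := by
  let p' : E ⟶ ModuleCat.of R (LinearMap.range p.hom) := ModuleCat.ofHom p.hom.rangeRestrict
  let v' : B ⟶ ModuleCat.of R (LinearMap.range p.hom) :=
    ModuleCat.ofHom (v.hom.codRestrict _ h)
  have : HasLiftingProperty i p' := hi p' <| (ModuleCat.epi_iff_surjective _).2
    p.hom.surjective_rangeRestrict
  have sq : CommSq u i p' v' := ⟨by
    ext a
    exact (ConcreteCategory.congr_hom w a).symm⟩
  refine ⟨sq.lift, sq.fac_left, ?_⟩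
  ext b
  exact congrArg Subtype.val (ConcreteCategory.congr_hom sq.fac_right b)

/-- A degreewise cofibration has the left lifting property with respect to the morphisms with the
lifting condition for disks. -/
lemma hasLiftingProperty_of_llp_epimorphisms (i : A ⟶ B)
    (hi : ∀ n, (epimorphisms (ModuleCat.{u} R)).llp (i.f n)) (p : X ⟶ Y) (hp : LiftsDisks p) :
    HasLiftingProperty i p := by
  refine ⟨fun {u v} sq ↦ ?_⟩
  let P (n : ℕ) (h : B.X n ⟶ X.X n) : Prop :=
    i.f n ≫ h = u.f n ∧ h ≫ p.f n = v.f n ∧ ∀ b, IsCycle X (h (B.d (n + 1) n b))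
  have base : ∃ h, P 0 h := by
    obtain ⟨h, h₁, h₂⟩ := exists_lift_of_forall_exists _ (hi 0) (p.f 0) (u.f 0) (v.f 0)
      (by rw [← comp_f, ← comp_f, sq.w]) (fun _ ↦ hp.surjective_zero _)
    exact ⟨h, h₁, h₂, fun _ ↦ isCycle_zero _⟩
  have step (n : ℕ) (h : B.X n ⟶ X.X n) (hh : P n h) :
      ∃ h', P (n + 1) h' ∧ h' ≫ X.d (n + 1) n = B.d (n + 1) n ≫ h := by
    obtain ⟨h₁, h₂, h₃⟩ := hh
    let F := ModuleCat.of R (X.X n × Y.X (n + 1))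
    let q : X.X (n + 1) ⟶ F :=
      ModuleCat.ofHom ((X.d (n + 1) n).hom.prod (p.f (n + 1)).hom)
    let w : B.X (n + 1) ⟶ F :=
      ModuleCat.ofHom ((B.d (n + 1) n ≫ h).hom.prod (v.f (n + 1)).hom)
    obtain ⟨h', h₁', h₂'⟩ := exists_lift_of_forall_exists _ (hi (n + 1)) q (u.f (n + 1)) w
      (by
        ext a
        · have : i.f (n + 1) ≫ B.d (n + 1) n ≫ h = u.f (n + 1) ≫ X.d (n + 1) n := by
            rw [i.comm_assoc, h₁, u.comm]
          exact ConcreteCategory.congr_hom this a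
        · have : i.f (n + 1) ≫ v.f (n + 1) = u.f (n + 1) ≫ p.f (n + 1) := by
            rw [← comp_f, ← comp_f, sq.w]
          exact ConcreteCategory.congr_hom this a)
      (fun b ↦ by
        obtain ⟨x, hx₁, hx₂⟩ := hp.exists_lift n (h (B.d (n + 1) n b)) (v.f (n + 1) b) (h₃ b) (by
          rw [← f_d_apply, ← h₂]
          rfl)
        exact ⟨x, Prod.ext hx₁ hx₂⟩)
    have h₃' : h' ≫ X.d (n + 1) n = B.d (n + 1) n ≫ h := by
      ext b
      exact congrArg Prod.fst (ConcreteCategory.congr_hom h₂' b)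
    refine ⟨h', ⟨h₁', ?_, fun b ↦ isCycle_succ_iff.2 ?_⟩, h₃'⟩
    · ext b
      exact congrArg Prod.snd (ConcreteCategory.congr_hom h₂' b)
    · refine (ConcreteCategory.congr_hom h₃' _).trans ?_
      exact (congrArg h (d_d_apply B _ _ _ b)).trans (map_zero _)
  choose next hnext hd using step
  obtain ⟨h₀, hh₀⟩ := base
  let H (n : ℕ) : { h // P n h } :=
    Nat.rec ⟨h₀, hh₀⟩ (fun n h ↦ ⟨next n h.1 h.2, hnext n h.1 h.2⟩) n
  let l : B ⟶ X :=
    { f n := (H n).1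
      comm' := by
        rintro _ n rfl
        exact hd n (H n).1 (H n).2 }
  exact ⟨⟨l, by ext1 n; exact (H n).2.1, by ext1 n; exact (H n).2.2.1⟩⟩

lemma llp_rlp_boundaryInclusion_iff (i : A ⟶ B) :
    (ofHoms (boundaryInclusion R)).rlp.llp i ↔
      ∀ n, Function.Injective (i.f n) ∧ Projective (cokernel (i.f n)) := by
  simp_rw [← ModuleCat.mono_iff_injective, ← llp_epimorphisms_iff]
  constructor
  · intro h n E F p (_ : Epi p)
    exact ((evalAdjunction R n).hasLiftingProperty_iff i p).2
      (h _ ((rlp_boundaryInclusion_iff _).2 (liftsDisks_map_diskFunctor n p)))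
  · intro h _ _ p hp
    exact hasLiftingProperty_of_llp_epimorphisms i h p ((rlp_boundaryInclusion_iff p).1 hp)

end Cofibrations

section TrivialCofibrations

open HomologicalComplex MorphismProperty
open scoped ZeroObject

variable {R : Type u} [Ring R] {A B : ChainComplex (ModuleCat.{u} R) ℕ}

/-- The projection from a disk to its quotient sphere. -/
noncomputable def diskProjection (n : ℕ) (M : ModuleCat.{u} R) : disk n M ⟶ sphere (n + 1) M :=
  mkHomToSingle (doubleXIso₀ (𝟙 M) (down_rel n)).hom (fun k hk ↦ by
    rw [double_d_eq_zero₁ _ _ _ _ (by simp), zero_comp])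

lemma surjective_to_single {K : ChainComplex (ModuleCat.{u} R) ℕ} {n : ℕ} {M : ModuleCat.{u} R}
    (p : K ⟶ sphere n M) {i : ℕ} (hi : i ≠ n) : Function.Surjective (p.f i) := by
  have := ModuleCat.subsingleton_of_isZero (isZero_single_obj_X (ComplexShape.down ℕ) n M i hi)
  exact fun y ↦ ⟨0, Subsingleton.elim _ _⟩

lemma rlp_zeroToDisk_diskProjection (n : ℕ) (M : ModuleCat.{u} R) :
    (ofHoms (zeroToDisk R)).rlp (diskProjection n M) := by
  rw [rlp_zeroToDisk_iff]
  intro i _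
  by_cases hi : i = n + 1
  · subst hi
    rw [← ModuleCat.epi_iff_surjective, diskProjection, mkHomToSingle_f]
    infer_instance
  · exact surjective_to_single _ hi

lemma exists_factor_of_llp (j : A ⟶ B) (hj : (ofHoms (zeroToDisk R)).rlp.llp j) {n : ℕ}
    {M : ModuleCat.{u} R} (q : B.X (n + 1) ⟶ M) (hq : B.d (n + 2) (n + 1) ≫ q = 0)
    (hjq : j.f (n + 1) ≫ q = 0) :
    ∃ φ : B.X n ⟶ M, B.d (n + 1) n ≫ φ = q ∧ j.f n ≫ φ = 0 := by
  have := hj _ (rlp_zeroToDisk_diskProjection n M)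
  have sq : CommSq 0 j (diskProjection n M) (mkHomToSingle q (by rintro _ rfl; exact hq)) := ⟨by
    apply to_single_hom_ext
    simp [reassoc_of% hjq]⟩
  obtain ⟨φ, h⟩ : ∃ φ, toDisk φ = sq.lift := (toDiskEquiv n B M).surjective _
  refine ⟨φ, ?_, ?_⟩
  · have := congr_hom sq.fac_right (n + 1)
    rw [← h] at this
    rw [← cancel_mono (singleObjXSelf (ComplexShape.down ℕ) (n + 1) M).inv]
    simpa [toDisk_f_succ, diskProjection] using this
  · have := congr_hom sq.fac_left n
    rw [← h] at this
    rw [← cancel_mono (doubleXIso₁ (𝟙 M) (down_rel n) (by simp)).inv]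
    simpa [toDisk_f] using this

lemma eq_zero_of_llp (j : A ⟶ B) (hj : (ofHoms (zeroToDisk R)).rlp.llp j)
    {M : ModuleCat.{u} R} (q : B.X 0 ⟶ M) (hq : B.d 1 0 ≫ q = 0) (hjq : j.f 0 ≫ q = 0) :
    q = 0 := by
  have := hj (0 : 0 ⟶ sphere 0 M) ((rlp_zeroToDisk_iff _).2 fun i hi ↦
    surjective_to_single _ (by lia))
  have sq : CommSq 0 j (0 : 0 ⟶ sphere 0 M) (mkHomToSingle q (by rintro _ rfl; exact hq)) := ⟨by
    apply to_single_hom_ext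
    simp only [zero_comp, comp_f, mkHomToSingle_f, reassoc_of% hjq]
    rfl⟩
  have := congr_hom sq.fac_right 0
  rw [comp_zero, zero_f, mkHomToSingle_f] at this
  rw [← cancel_mono (singleObjXSelf (ComplexShape.down ℕ) 0 M).inv, zero_comp]
  exact this.symm

lemma exists_add_d_of_llp (j : A ⟶ B) (hj : (ofHoms (zeroToDisk R)).rlp.llp j) {n : ℕ}
    (x : B.X n) (hx : ∀ m, n = m + 1 → ∃ a, B.d n m x = j.f m a) :
    ∃ a y, x = j.f n a + B.d (n + 1) n y := by
  let S : Submodule R (B.X n) := LinearMap.range (j.f n).hom ⊔ LinearMap.range (B.d (n + 1) n).hom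
  let q : B.X n ⟶ ModuleCat.of R (B.X n ⧸ S) := ModuleCat.ofHom S.mkQ
  have hq : B.d (n + 1) n ≫ q = 0 := by
    ext y
    exact (Submodule.Quotient.mk_eq_zero _).2 (Submodule.mem_sup_right ⟨y, rfl⟩)
  have hjq : j.f n ≫ q = 0 := by
    ext y
    exact (Submodule.Quotient.mk_eq_zero _).2 (Submodule.mem_sup_left ⟨y, rfl⟩)
  have hqx : q x = 0 := by
    cases n with
    | zero => rw [eq_zero_of_llp j hj q hq hjq]; rfl
    | succ n =>
      obtain ⟨φ, h, hjφ⟩ := exists_factor_of_llp j hj q hq hjq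
      obtain ⟨a, ha⟩ := hx n rfl
      rw [← h, ConcreteCategory.comp_apply, ha]
      exact ConcreteCategory.congr_hom hjφ a
  obtain ⟨_, ⟨a, rfl⟩, _, ⟨y, rfl⟩, h⟩ :=
    Submodule.mem_sup.1 ((Submodule.Quotient.mk_eq_zero S).1 hqx)
  exact ⟨a, y, h.symm⟩

lemma quasiIso_of_llp_rlp_zeroToDisk (j : A ⟶ B) (hj : (ofHoms (zeroToDisk R)).rlp.llp j) :
    QuasiIso j := by
  have hinj (n : ℕ) : Function.Injective (j.f n) := by
    refine ((llp_rlp_boundaryInclusion_iff j).1 (antitone_llp ?_ _ hj) n).1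
    intro _ _ g hg
    exact (rlp_zeroToDisk_iff g).2 ((liftsDisks_iff g).1 ((rlp_boundaryInclusion_iff g).1 hg)).1
  rw [quasiIso_iff_elements]
  refine fun n ↦ ⟨fun x y _ hxy ↦ ?_, fun y hy ↦ ?_⟩
  · obtain ⟨a, z, rfl⟩ := exists_add_d_of_llp j hj y (by
      rintro m h
      obtain rfl : n = m := by lia
      exact ⟨x, hxy.symm⟩)
    refine ⟨a, hinj _ ?_⟩
    rw [hxy, map_add, d_d_apply, add_zero, f_d_apply]
  · obtain ⟨a, z, rfl⟩ := exists_add_d_of_llp j hj y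
      (fun m _ ↦ ⟨0, by rw [hy, map_zero]⟩)
    refine ⟨a, z, fun k ↦ hinj _ ?_, rfl⟩
    rw [f_d_apply, map_zero]
    simpa [d_d_apply] using hy k

end TrivialCofibrations

section SimplicialModules

open MorphismProperty
open scoped ZeroObject

variable (R : Type u) [Ring R]

attribute [local instance] Cardinal.fact_isRegular_aleph0

/-- The Dold-Kan equivalence for modules, whose functor is the normalization functor. -/
noncomputable abbrev doldKan :
    SimplicialObject (ModuleCat.{u} R) ≌ ChainComplex (ModuleCat.{u} R) ℕ :=
  Abelian.DoldKan.equivalence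

/-- The generating cofibrations of simplicial modules. -/
def generatingCofibrations : MorphismProperty (SimplicialObject (ModuleCat.{u} R)) :=
  ofHoms fun n ↦ (doldKan R).inverse.map (boundaryInclusion R n)

/-- The generating trivial cofibrations of simplicial modules. -/
def generatingTrivialCofibrations : MorphismProperty (SimplicialObject (ModuleCat.{u} R)) :=
  ofHoms fun n ↦ (doldKan R).inverse.map (zeroToDisk R n)

instance : IsSmall.{u} (generatingCofibrations R) := isSmall_ofHoms _

instance : IsSmall.{u} (generatingTrivialCofibrations R) := isSmall_ofHoms _

lemma isFinitelyPresentable_of_generatingCofibrations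
    ⦃A B : SimplicialObject (ModuleCat.{u} R)⦄ (f : A ⟶ B) (hf : generatingCofibrations R f) :
    IsFinitelyPresentable.{u} A := by
  obtain ⟨n⟩ := hf
  have : IsFinitelyPresentable.{u} (boundary R n) := inferInstance
  infer_instance

lemma isFinitelyPresentable_of_generatingTrivialCofibrations
    ⦃A B : SimplicialObject (ModuleCat.{u} R)⦄ (f : A ⟶ B)
    (hf : generatingTrivialCofibrations R f) : IsFinitelyPresentable.{u} A := by
  obtain ⟨n⟩ := hf
  infer_instance

/-- The morphisms of simplicial modules whose normalization is a quasi-isomorphism. -/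
def weakEquivalences : MorphismProperty (SimplicialObject (ModuleCat.{u} R)) :=
  (HomologicalComplex.quasiIso (ModuleCat.{u} R) (ComplexShape.down ℕ)).inverseImage
    (AlgebraicTopology.normalizedMooreComplex (ModuleCat.{u} R))

instance : (weakEquivalences R).HasTwoOutOfThreeProperty := by
  unfold weakEquivalences; infer_instance

instance : (weakEquivalences R).IsStableUnderRetracts := by
  unfold weakEquivalences; infer_instance

lemma hasSmallObjectArgument_generatingCofibrations :
    HasSmallObjectArgument.{u} (generatingCofibrations R) :=
  hasSmallObjectArgument_of_isFinitelyPresentable _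
    (isFinitelyPresentable_of_generatingCofibrations R)

lemma hasSmallObjectArgument_generatingTrivialCofibrations :
    HasSmallObjectArgument.{u} (generatingTrivialCofibrations R) :=
  hasSmallObjectArgument_of_isFinitelyPresentable _
    (isFinitelyPresentable_of_generatingTrivialCofibrations R)

variable {R} {X Y : SimplicialObject (ModuleCat.{u} R)} (f : X ⟶ Y)

lemma rlp_generatingTrivialCofibrations_iff :
    (generatingTrivialCofibrations R).rlp f ↔ ∀ i : ℕ, 1 ≤ i → Function.Surjective
      (((AlgebraicTopology.normalizedMooreComplex (ModuleCat.{u} R)).map f).f i) :=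
  (rlp_ofHoms_map (doldKan R).symm.toAdjunction _ f).trans (rlp_zeroToDisk_iff _)

lemma llp_rlp_generatingCofibrations_iff :
    (generatingCofibrations R).rlp.llp f ↔ ∀ i : ℕ, Function.Injective
        (((AlgebraicTopology.normalizedMooreComplex (ModuleCat.{u} R)).map f).f i) ∧
      Projective
        (cokernel (((AlgebraicTopology.normalizedMooreComplex (ModuleCat.{u} R)).map f).f i)) :=
  (llp_rlp_ofHoms_map (doldKan R) _ f).trans (llp_rlp_boundaryInclusion_iff _)

lemma rlp_generatingCofibrations :
    (generatingCofibrations R).rlp =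
      (generatingTrivialCofibrations R).rlp ⊓ weakEquivalences R := by
  ext X Y f
  exact ((rlp_ofHoms_map (doldKan R).symm.toAdjunction _ f).trans
    ((rlp_boundaryInclusion_iff _).trans (liftsDisks_iff _))).trans
      (and_congr (rlp_generatingTrivialCofibrations_iff f).symm Iff.rfl)

lemma llp_rlp_generatingTrivialCofibrations_le :
    (generatingTrivialCofibrations R).rlp.llp ≤ weakEquivalences R :=
  fun _ _ f hf ↦ quasiIso_of_llp_rlp_zeroToDisk _ ((llp_rlp_ofHoms_map (doldKan R) _ f).1 hf)

variable (R) in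
/-- The projective model structure on simplicial modules. -/
noncomputable def simplicialModuleModelStructure :
    ModelStructure (SimplicialObject (ModuleCat.{u} R)) :=
  have := hasSmallObjectArgument_generatingCofibrations R
  have := hasSmallObjectArgument_generatingTrivialCofibrations R
  .ofGenerators (weakEquivalences R) (generatingCofibrations R) (generatingTrivialCofibrations R)
    rlp_generatingCofibrations llp_rlp_generatingTrivialCofibrations_le

variable (R) in
lemma isCofibrantlyGenerated_simplicialModuleModelStructure :
    IsCofibrantlyGenerated (simplicialModuleModelStructure R)
      {a | generatingCofibrations R a.hom} {a | generatingTrivialCofibrations R a.hom} where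
  permits_I := permitsSOA_of_isFinitelyPresentable _
    (isFinitelyPresentable_of_generatingCofibrations R)
  permits_J := permitsSOA_of_isFinitelyPresentable _
    (isFinitelyPresentable_of_generatingTrivialCofibrations R)
  rlp_I g := by
    rw [ofArrows_setOf, rlp_eq, rlp_generatingCofibrations]
    rfl
  rlp_J g := by
    rw [ofArrows_setOf, rlp_eq]
    rfl

end SimplicialModules

end Paper

open CategoryTheory Limits Paper in
/-- **Theorem 4.15.** For any ring `R`, the category of simplicial left `R`-modules is a
cofibrantly generated model category where a morphism `f` is a fibration if `Nor(f)` is surjective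
in all positive degrees, a cofibration if `Nor(f)` is degreewise injective with projective
cokernels, and a weak equivalence if `Nor(f)` is a quasi-isomorphism, `Nor` being the
normalization functor. -/
theorem statement1 (R : Type) [Ring R] :
    ∃ M : ModelStructure (CategoryTheory.SimplicialObject (ModuleCat R)),
      (∀ {X Y : CategoryTheory.SimplicialObject (ModuleCat R)} (f : X ⟶ Y),
        M.Fib f ↔ ∀ i : ℕ, 1 ≤ i →
          Function.Surjective
            (((AlgebraicTopology.normalizedMooreComplex (ModuleCat R)).map f).f i)) ∧
      (∀ {X Y : CategoryTheory.SimplicialObject (ModuleCat R)} (f : X ⟶ Y),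
        M.Cof f ↔ ∀ i : ℕ,
          Function.Injective
            (((AlgebraicTopology.normalizedMooreComplex (ModuleCat R)).map f).f i) ∧
          Projective
            (cokernel (((AlgebraicTopology.normalizedMooreComplex (ModuleCat R)).map f).f i))) ∧
      (∀ {X Y : CategoryTheory.SimplicialObject (ModuleCat R)} (f : X ⟶ Y),
        M.W f ↔ QuasiIso ((AlgebraicTopology.normalizedMooreComplex (ModuleCat R)).map f)) ∧
      ∃ (I J : Set (Arrow (CategoryTheory.SimplicialObject (ModuleCat R)))),
        IsCofibrantlyGenerated M I J := by
  exact ⟨simplicialModuleModelStructure R, rlp_generatingTrivialCofibrations_iff,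
    llp_rlp_generatingCofibrations_iff, fun _ ↦ Iff.rfl, _, _,
    isCofibrantlyGenerated_simplicialModuleModelStructure R⟩
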